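/- Let 𝒥 be a proper constrained level graph of height 3 without isolated vertices and let Γ be a constrained level planar drawing of 𝒥. Then every connected component of 𝒥 that is enclosed (in Γ) by another connected component has vertices on exactly two levels, and its underlying undirected graph is a caterpillar. -/

import Mathlib

open scoped Classical

/-- A constrained level graph: a finite directed graph with a surjective level
assignment `lvl : V → {1, …, h}` such that edges go strictly upwards, together
with a partial order `≺ᵢ` on each level. -/
structure ConstrainedLevelGraph (V : Type) [Fintype V] where
  h : ℕ
  Edge : V → V → Prop
  lvl : V → ℕ
  lvl_one_le : ∀ v, 1 ≤ lvl v
  lvl_le : ∀ v, lvl v ≤ h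
  lvl_surj : ∀ i, 1 ≤ i → i ≤ h → ∃ v, lvl v = i
  edge_lt : ∀ u v, Edge u v → lvl u < lvl v
  prec : ℕ → V → V → Prop
  prec_lvl : ∀ i u v, prec i u v → lvl u = i ∧ lvl v = i
  prec_irrefl : ∀ i v, ¬ prec i v v
  prec_trans : ∀ i a b c, prec i a b → prec i b c → prec i a c

/-- A constrained level planar drawing. -/
structure CLPDrawing {V : Type} [Fintype V] (G : ConstrainedLevelGraph V) where
  x : V → ℝ
  f : V → V → ℝ → ℝ
  x_inj : ∀ u v, G.lvl u = G.lvl v → x u = x v → u = v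
  f_cont : ∀ u v, G.Edge u v → ContinuousOn (f u v) (Set.Icc (G.lvl u : ℝ) (G.lvl v : ℝ))
  f_src : ∀ u v, G.Edge u v → f u v (G.lvl u : ℝ) = x u
  f_tgt : ∀ u v, G.Edge u v → f u v (G.lvl v : ℝ) = x v
  planar : ∀ u v u' v', G.Edge u v → G.Edge u' v' → (u, v) ≠ (u', v') →
    ∀ t : ℝ, t ∈ Set.Icc (G.lvl u : ℝ) (G.lvl v : ℝ) →
      t ∈ Set.Icc (G.lvl u' : ℝ) (G.lvl v' : ℝ) → f u v t = f u' v' t →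
      ∃ w, (w = u ∨ w = v) ∧ (w = u' ∨ w = v') ∧ t = (G.lvl w : ℝ) ∧ f u v t = x w
  no_through : ∀ u v w, G.Edge u v → w ≠ u → w ≠ v →
    G.lvl u ≤ G.lvl w → G.lvl w ≤ G.lvl v → f u v (G.lvl w : ℝ) ≠ x w
  prec_ok : ∀ i u v, G.prec i u v → x u < x v

variable {V : Type} [Fintype V]

/-- Undirected reachability (being in the same connected component). -/
def Reach (G : ConstrainedLevelGraph V) : V → V → Prop :=
  Relation.ReflTransGen fun u v => G.Edge u v ∨ G.Edge v u

/-- The span of a vertex set `X` in the drawing `D`: the set of middle-level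
(level 2) vertices lying in the smallest interval (with respect to the
x-coordinates) containing all middle-level vertices of `X`. -/
def SpanSet (G : ConstrainedLevelGraph V) (D : CLPDrawing G) (X : Set V) : Set V :=
  {w | G.lvl w = 2 ∧ ∃ u ∈ X, ∃ v ∈ X, G.lvl u = 2 ∧ G.lvl v = 2 ∧
        D.x u ≤ D.x w ∧ D.x w ≤ D.x v}

/-- The set `A` encloses the set `B` in the drawing `D`. -/
def Encloses (G : ConstrainedLevelGraph V) (D : CLPDrawing G) (A B : Set V) : Prop :=
  SpanSet G D B ⊂ SpanSet G D A

/-- The graph induced by `G` on the vertex set `W` (as an undirected simple graph). -/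
def inducedSG (G : ConstrainedLevelGraph V) (W : Set V) : SimpleGraph W :=
  SimpleGraph.fromRel fun u v => G.Edge u.1 v.1

/-- A caterpillar: a tree in which every vertex is within distance at most one
of a central path. -/
def IsCaterpillar {α : Type} (H : SimpleGraph α) : Prop :=
  H.Connected ∧ H.IsAcyclic ∧
    ∃ p : List α, p ≠ [] ∧ p.Chain' H.Adj ∧ p.Nodup ∧
      ∀ v : α, v ∈ p ∨ ∃ w ∈ p, H.Adj v w

/-- The vertex set `W` occupies exactly two levels. -/
def TwoLevels (G : ConstrainedLevelGraph V) (W : Set V) : Prop :=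
  ∃ i j, i ≠ j ∧ (∃ v ∈ W, G.lvl v = i) ∧ (∃ v ∈ W, G.lvl v = j) ∧
    ∀ v ∈ W, G.lvl v = i ∨ G.lvl v = j

/-- A two-layer drawing without crossings of a bipartite graph: `side` tells the two layers
apart and `pos` gives the position of each vertex in its layer. -/
structure IsTwoLayerDrawing {α : Type} (H : SimpleGraph α) (side : α → Prop) (pos : α → ℝ) :
    Prop where
  side_iff_not : ∀ {u v}, H.Adj u v → (side u ↔ ¬ side v)
  pos_inj : ∀ {u v}, (side u ↔ side v) → pos u = pos v → u = v
  pos_lt_iff : ∀ {u v u' v'}, H.Adj u v → H.Adj u' v' → side u → side u' → u ≠ u' → v ≠ v' →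
    (pos u < pos u' ↔ pos v < pos v')

namespace IsTwoLayerDrawing

variable {α : Type} {H : SimpleGraph α} {side : α → Prop} {pos : α → ℝ}

theorem isAcyclic [Finite α] (hD : IsTwoLayerDrawing H side pos) : H.IsAcyclic := by
  intro r c hc
  have exists_ne : ∀ w ∈ c.support, ∀ z, ∃ y, y ≠ z ∧ c.toSubgraph.Adj w y := by
    intro w hw z
    obtain ⟨y, hy, hyz⟩ := Set.exists_ne_of_one_lt_ncard
      (by rw [hc.ncard_neighborSet_toSubgraph_eq_two hw]; norm_num :
        1 < (c.toSubgraph.neighborSet w).ncard) z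
    exact ⟨y, hyz, hy⟩
  have mem_of_adj : ∀ {w y}, c.toSubgraph.Adj w y → y ∈ c.support := fun h =>
    (SimpleGraph.Walk.mem_verts_toSubgraph c).1 h.snd_mem
  obtain ⟨y, -, hy⟩ := exists_ne r c.start_mem_support r
  have hne : {w | w ∈ c.support ∧ side w}.Nonempty := by
    by_cases hr : side r
    · exact ⟨r, c.start_mem_support, hr⟩
    · exact ⟨y, mem_of_adj hy, (hD.side_iff_not hy.adj_sub.symm).2 hr⟩
  obtain ⟨u, ⟨huc, hu⟩, hmax⟩ :=
    Set.exists_max_image {w | w ∈ c.support ∧ side w} pos (Set.toFinite _) hne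
  obtain ⟨v₁, -, h₁⟩ := exists_ne u huc u
  obtain ⟨v₂, hv, h₂⟩ := exists_ne u huc v₁
  have key : ∀ {v v'}, c.toSubgraph.Adj u v → c.toSubgraph.Adj u v' → v' ≠ v →
      ¬ pos v' < pos v := by
    intro v v' h h' hvv hlt
    obtain ⟨u', huu, h''⟩ := exists_ne v (mem_of_adj h) u
    have hu' : side u' := (hD.side_iff_not h''.adj_sub.symm).2
      ((hD.side_iff_not h.adj_sub).1 hu)
    have hle := hmax u' ⟨mem_of_adj h'', hu'⟩
    have := (hD.pos_lt_iff h'.adj_sub h''.adj_sub.symm hu hu' huu.symm hvv).2 hlt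
    linarith
  refine hv (hD.pos_inj ?_ (le_antisymm (not_lt.1 (key h₂ h₁ hv.symm)) (not_lt.1 (key h₁ h₂ hv))))
  have a₁ := hD.side_iff_not h₁.adj_sub
  have a₂ := hD.side_iff_not h₂.adj_sub
  tauto

/-- A walk avoiding both ends of an edge stays on one side of that edge. -/
theorem left_of_edge (hD : IsTwoLayerDrawing H side pos) {b m : α} (hb : side b)
    (hbm : H.Adj b m) {s t : α} (p : H.Walk s t) (hpb : b ∉ p.support) (hpm : m ∉ p.support)
    (hs : (side s → pos s < pos b) ∧ (¬ side s → pos s < pos m)) :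
    (side t → pos t < pos b) ∧ (¬ side t → pos t < pos m) := by
  induction p with
  | nil => exact hs
  | @cons s y t h p ih =>
    simp only [SimpleGraph.Walk.support_cons, List.mem_cons, not_or] at hpb hpm
    have hyb : y ≠ b := fun e => hpb.2 (e ▸ p.start_mem_support)
    have hym : y ≠ m := fun e => hpm.2 (e ▸ p.start_mem_support)
    have hsy := hD.side_iff_not h
    refine ih hpb.2 hpm.2 ?_
    by_cases hside : side s
    · have hlt := (hD.pos_lt_iff h hbm hside hb (Ne.symm hpb.1) hym).1 (hs.1 hside)
      exact ⟨fun hy => absurd hy (hsy.1 hside), fun _ => hlt⟩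
    · have hy : side y := by tauto
      have hlt := (hD.pos_lt_iff h.symm hbm hy hb hyb (Ne.symm hpm.1)).2 (hs.2 hside)
      exact ⟨fun _ => hlt, fun h => absurd hy h⟩

theorem isCaterpillar [Finite α] (hD : IsTwoLayerDrawing H side pos) (hconn : H.Connected)
    (hadj : ∀ v, ∃ w, H.Adj v w) : IsCaterpillar H := by
  refine ⟨hconn, hD.isAcyclic, ?_⟩
  have hne : {w | side w}.Nonempty := by
    obtain ⟨r⟩ := hconn.nonempty
    obtain ⟨y, hy⟩ := hadj r
    by_cases hr : side r
    · exact ⟨r, hr⟩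
    · exact ⟨y, (hD.side_iff_not hy.symm).2 hr⟩
  obtain ⟨s, hs, hmin⟩ := Set.exists_min_image {w | side w} pos (Set.toFinite _) hne
  obtain ⟨t, ht, hmax⟩ := Set.exists_max_image {w | side w} pos (Set.toFinite _) hne
  obtain ⟨p, hp⟩ := hconn.exists_isPath s t
  have spine : ∀ {b m}, side b → H.Adj b m → b ∈ p.support ∨ m ∈ p.support := by
    intro b m hb hbm
    by_contra! hnot
    have hsb : pos s < pos b := lt_of_le_of_ne (hmin b hb) fun e =>
      hnot.1 (hD.pos_inj (iff_of_true hs hb) e ▸ p.start_mem_support)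
    have := (hD.left_of_edge hb hbm p hnot.1 hnot.2 ⟨fun _ => hsb, fun h => absurd hs h⟩).1 ht
    exact absurd (hmax b hb) (not_le.2 this)
  refine ⟨p.support, p.support_ne_nil, p.isChain_adj_support, hp.support_nodup, fun v => ?_⟩
  obtain ⟨w, hw⟩ := hadj v
  have : v ∈ p.support ∨ w ∈ p.support := by
    by_cases hv : side v
    · exact spine hv hw
    · exact (spine ((hD.side_iff_not hw.symm).2 hv) hw.symm).symm
  exact this.imp_right fun h => ⟨w, h, hw⟩

end IsTwoLayerDrawing

theorem Reach.symm {G : ConstrainedLevelGraph V} {u v : V} (h : Reach G u v) : Reach G v u := by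
  induction h with
  | refl => exact .refl
  | tail _ h ih => exact ih.head h.symm

/-- Disjoint edges between the same two consecutive levels do not cross. -/
theorem CLPDrawing.x_lt_iff {G : ConstrainedLevelGraph V} (D : CLPDrawing G)
    (hproper : ∀ u v, G.Edge u v → G.lvl v = G.lvl u + 1) {u v u' v' : V}
    (h : G.Edge u v) (h' : G.Edge u' v') (hl : G.lvl u = G.lvl u') (hu : u ≠ u') (hv : v ≠ v') :
    D.x u < D.x u' ↔ D.x v < D.x v' := by
  have hv1 := hproper _ _ h
  have hv1' := hproper _ _ h'
  have hl' : G.lvl v = G.lvl v' := by omega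
  have hle : (G.lvl u : ℝ) ≤ G.lvl v := by exact_mod_cast (G.edge_lt _ _ h).le
  have hcont : ContinuousOn (fun t => D.f u v t - D.f u' v' t)
      (Set.Icc (G.lvl u : ℝ) (G.lvl v)) := by
    refine (D.f_cont u v h).sub ?_
    rw [hl, hl']
    exact D.f_cont u' v' h'
  have hsrc : D.f u v (G.lvl u) - D.f u' v' (G.lvl u) = D.x u - D.x u' := by
    rw [D.f_src u v h, hl, D.f_src u' v' h']
  have htgt : D.f u v (G.lvl v) - D.f u' v' (G.lvl v) = D.x v - D.x v' := by
    rw [D.f_tgt u v h, hl', D.f_tgt u' v' h']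
  have hno : ¬ ∃ t ∈ Set.Icc (G.lvl u : ℝ) (G.lvl v), D.f u v t - D.f u' v' t = 0 := by
    rintro ⟨t, ht, h0⟩
    obtain ⟨w, hw, hw', -⟩ := D.planar u v u' v' h h' (fun e => hu (congrArg Prod.fst e)) t ht
      (by rw [← hl, ← hl']; exact ht) (sub_eq_zero.1 h0)
    rcases hw with rfl | rfl <;> rcases hw' with rfl | rfl
    · exact hu rfl
    · omega
    · omega
    · exact hv rfl
  constructor
  · intro hlt
    by_contra! hge
    refine hno (intermediate_value_Icc hle hcont ⟨?_, ?_⟩) <;> simp only [hsrc, htgt] <;> linarith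
  · intro hlt
    by_contra! hge
    refine hno (intermediate_value_Icc' hle hcont ⟨?_, ?_⟩) <;> simp only [hsrc, htgt] <;> linarith

/-- A component with vertices on levels `1` and `3` contains a middle vertex with neighbours on
both of these levels. -/
theorem exists_edge_edge_of_reach {G : ConstrainedLevelGraph V} (hh : G.h = 3)
    (hproper : ∀ u v, G.Edge u v → G.lvl v = G.lvl u + 1) {r q : V} (hrq : Reach G r q)
    (hr : G.lvl r = 1) (hq : G.lvl q = 3) :
    ∃ p m t, Reach G r m ∧ G.Edge p m ∧ G.Edge m t := by
  by_contra! hno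
  have inv : ∀ y, Reach G r y → G.lvl y = 1 ∨ (G.lvl y = 2 ∧ ∃ p, G.Edge p y) := by
    intro y hy
    induction hy with
    | refl => exact Or.inl hr
    | @tail y z hy hyz ih =>
      have hz := G.lvl_le z
      rcases hyz with hyz | hzy
      · have := hproper _ _ hyz
        rcases ih with ih | ⟨ih, p, hp⟩
        · exact Or.inr ⟨by omega, y, hyz⟩
        · exact absurd hyz (hno p y z hy hp)
      · have := hproper _ _ hzy
        have := G.lvl_one_le z
        exact Or.inl (by omega)
  have := inv q hrq
  omega

/-- A path through all three levels separates the components to its left from those to its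
right. -/
theorem CLPDrawing.x_lt_of_reach {G : ConstrainedLevelGraph V} (D : CLPDrawing G) (hh : G.h = 3)
    (hproper : ∀ u v, G.Edge u v → G.lvl v = G.lvl u + 1) {p m t u v : V}
    (hpm : G.Edge p m) (hmt : G.Edge m t) (hmu : ¬ Reach G m u) (huv : Reach G u v)
    (hu : G.lvl u = 2) (hv : G.lvl v = 2) (hlt : D.x u < D.x m) : D.x v < D.x m := by
  have hp := hproper _ _ hpm
  have ht := hproper _ _ hmt
  have hp1 := G.lvl_one_le p
  have ht3 := G.lvl_le t
  have avoid : ∀ {y z}, Reach G m z → Reach G u y → y ≠ z := by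
    rintro y _ hz hy rfl
    exact hmu (hz.trans (Reach.symm hy))
  have hm' : Reach G m m := .refl
  have hp' : Reach G m p := .single (Or.inr hpm)
  have ht' : Reach G m t := .single (Or.inl hmt)
  have inv : ∀ y, Reach G u y → (G.lvl y = 1 → D.x y < D.x p) ∧
      (G.lvl y = 2 → D.x y < D.x m) ∧ (G.lvl y = 3 → D.x y < D.x t) := by
    have step : ∀ {y z}, G.Edge y z → Reach G u y → Reach G u z →
        (G.lvl y = 1 → (D.x y < D.x p ↔ D.x z < D.x m)) ∧
        (G.lvl y = 2 → (D.x y < D.x m ↔ D.x z < D.x t)) := fun h hy hz =>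
      ⟨fun e => D.x_lt_iff hproper h hpm (by omega) (avoid hp' hy) (avoid hm' hz),
        fun e => D.x_lt_iff hproper h hmt (by omega) (avoid hm' hy) (avoid ht' hz)⟩
    intro y hy
    induction hy with
    | refl => exact ⟨by omega, fun _ => hlt, by omega⟩
    | @tail y z hy hyz ih =>
      have hz : Reach G u z := hy.tail hyz
      have := G.lvl_le z
      have := G.lvl_le y
      have := G.lvl_one_le z
      have := G.lvl_one_le y
      rcases hyz with hyz | hzy
      · obtain ⟨s₁, s₂⟩ := step hyz hy hz
        have := hproper _ _ hyz
        exact ⟨by omega, fun e => (s₁ (by omega)).1 (ih.1 (by omega)),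
          fun e => (s₂ (by omega)).1 (ih.2.1 (by omega))⟩
      · obtain ⟨s₁, s₂⟩ := step hzy hz hy
        have := hproper _ _ hzy
        exact ⟨fun e => (s₁ e).2 (ih.2.1 (by omega)),
          fun e => (s₂ e).2 (ih.2.2 (by omega)), by omega⟩
  exact (inv v huv).2.1 hv

theorem inducedSG_adj {G : ConstrainedLevelGraph V} {W : Set V} {u v : W} :
    (inducedSG G W).Adj u v ↔ G.Edge u v ∨ G.Edge v u := by
  refine ⟨fun h => h.2, fun h => ⟨?_, h⟩⟩
  rintro rfl
  exact h.elim (fun h => (G.edge_lt _ _ h).false) fun h => (G.edge_lt _ _ h).false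

theorem inducedSG_connected (G : ConstrainedLevelGraph V) (a : V) :
    (inducedSG G {v | Reach G a v}).Connected := by
  have key : ∀ v (hv : Reach G a v),
      (inducedSG G {v | Reach G a v}).Reachable ⟨a, .refl⟩ ⟨v, hv⟩ := by
    intro v hv
    induction hv with
    | refl => exact .refl _
    | @tail y z hy hyz ih =>
      exact ih.trans (SimpleGraph.Adj.reachable (inducedSG_adj.2 hyz))
  exact { preconnected := fun u v => (key u u.2).symm.trans (key v v.2)
          nonempty := ⟨⟨a, .refl⟩⟩ }

/-- Components on two consecutive levels of a proper drawing are caterpillars. -/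
theorem CLPDrawing.isCaterpillar_component {G : ConstrainedLevelGraph V} (D : CLPDrawing G)
    (hproper : ∀ u v, G.Edge u v → G.lvl v = G.lvl u + 1)
    (hiso : ∀ v : V, ∃ u, G.Edge u v ∨ G.Edge v u) {a : V} {k : ℕ}
    (hk : ∀ v, Reach G a v → G.lvl v = k ∨ G.lvl v = k + 1) :
    IsCaterpillar (inducedSG G {v | Reach G a v}) := by
  have hD : IsTwoLayerDrawing (inducedSG G {v | Reach G a v})
      (fun v => G.lvl v = k) (fun v => D.x v) := by
    have up : ∀ {u v : {v | Reach G a v}}, (inducedSG G {v | Reach G a v}).Adj u v →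
        G.lvl u = k → G.Edge u v := by
      intro u v h hu
      refine (inducedSG_adj.1 h).resolve_right fun h => ?_
      have := hproper _ _ h
      have := hk v v.2
      omega
    refine ⟨?_, ?_, ?_⟩
    · intro u v h
      have hu := hk u u.2
      have hv := hk v v.2
      rcases inducedSG_adj.1 h with h | h <;> have := hproper _ _ h <;> omega
    · intro u v h e
      have hu := hk u u.2
      have hv := hk v v.2
      exact Subtype.ext (D.x_inj _ _ (by omega) e)
    · intro u v u' v' h h' hu hu' huu hvv
      exact D.x_lt_iff hproper (up h hu) (up h' hu') (hu.trans hu'.symm)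
        (fun e => huu (Subtype.ext e)) (fun e => hvv (Subtype.ext e))
  refine hD.isCaterpillar (inducedSG_connected G a) fun v => ?_
  obtain ⟨u, hu⟩ := hiso v
  exact ⟨⟨u, Relation.ReflTransGen.tail v.2 hu.symm⟩, inducedSG_adj.2 hu.symm⟩

/-- A component enclosed by another one misses level `1` or level `3`. -/
theorem CLPDrawing.not_lvl_one_and_lvl_three {G : ConstrainedLevelGraph V} (D : CLPDrawing G)
    (hh : G.h = 3) (hproper : ∀ u v, G.Edge u v → G.lvl v = G.lvl u + 1) {a b : V}
    (hab : ¬ Reach G a b) (hencl : Encloses G D {v | Reach G b v} {v | Reach G a v})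
    {r q : V} (har : Reach G a r) (haq : Reach G a q) (hr : G.lvl r = 1) : G.lvl q ≠ 3 := by
  intro hq
  obtain ⟨p, m, t, hrm, hpm, hmt⟩ :=
    exists_edge_edge_of_reach hh hproper ((Reach.symm har).trans haq) hr hq
  have hm : G.lvl m = 2 := by
    have := hproper _ _ hpm
    have := hproper _ _ hmt
    have := G.lvl_one_le p
    have := G.lvl_le t
    omega
  have ham : Reach G a m := har.trans hrm
  obtain ⟨-, u, hbu, v, hbv, hu, hv, hum, hmv⟩ :=
    hencl.1 (show m ∈ SpanSet G D {v | Reach G a v} from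
      ⟨hm, m, ham, m, ham, hm, hm, le_rfl, le_rfl⟩)
  have hmu : ¬ Reach G m u := fun h => hab ((ham.trans h).trans (Reach.symm hbu))
  have hlt : D.x u < D.x m := lt_of_le_of_ne hum fun e =>
    hmu (D.x_inj u m (hu.trans hm.symm) e ▸ .refl)
  have := D.x_lt_of_reach hh hproper hpm hmt hmu ((Reach.symm hbu).trans hbv) hu hv hlt
  linarith

/-- In a constrained level planar drawing of a proper constrained
level graph of height 3 without isolated vertices, every connected component
enclosed by another component occupies exactly two levels and is a caterpillar. -/
theorem enclosed_components_are_caterpillars (G : ConstrainedLevelGraph V)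
    (hh : G.h = 3)
    (hproper : ∀ u v, G.Edge u v → G.lvl v = G.lvl u + 1)
    (hiso : ∀ v : V, ∃ u, G.Edge u v ∨ G.Edge v u)
    (D : CLPDrawing G) (a : V)
    (hencl : ∃ b, ¬ Reach G a b ∧
      Encloses G D {v | Reach G b v} {v | Reach G a v}) :
    TwoLevels G {v | Reach G a v} ∧
      IsCaterpillar (inducedSG G {v | Reach G a v}) := by
  obtain ⟨b, hab, hencl⟩ := hencl
  obtain ⟨k, hk⟩ : ∃ k, ∀ v, Reach G a v → G.lvl v = k ∨ G.lvl v = k + 1 := by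
    by_cases hr : ∃ r, Reach G a r ∧ G.lvl r = 1
    · obtain ⟨r, har, hr⟩ := hr
      refine ⟨1, fun v hv => ?_⟩
      have := D.not_lvl_one_and_lvl_three hh hproper hab hencl har hv hr
      have := G.lvl_le v
      have := G.lvl_one_le v
      omega
    · push Not at hr
      refine ⟨2, fun v hv => ?_⟩
      have := hr v hv
      have := G.lvl_le v
      have := G.lvl_one_le v
      omega
  refine ⟨⟨k, k + 1, by omega, ?_, ?_, hk⟩, D.isCaterpillar_component hproper hiso hk⟩ <;>
  · obtain ⟨u, hu⟩ := hiso a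
    have hau : Reach G a u := .single hu.symm
    have ha := hk a .refl
    have hu' := hk u hau
    by_contra! hno
    have h₁ := hno a .refl
    have h₂ := hno u hau
    rcases hu with hu | hu <;> have := hproper _ _ hu <;> omega
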